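/- For every weakly-hierarchical visibly pushdown automaton A, the function tops is the smallest function f : Q → 2^{Q ∪ {⊥}} (with respect to pointwise set inclusion) satisfying: (1) if q ∈ Q0 then ⊥ ∈ f(q); (2) if q̂ ∈ f(q) and (q, a, q') ∈ δ_int then q̂ ∈ f(q'); (3) if (q, σ) is reachable for some stack σ and (q, c, q') ∈ δ_call then q ∈ f(q'); (4) if q̂ ∈ f(q) and (q, r, q̂, q') ∈ δ_ret then f(q̂) ⊆ f(q'). That is, tops satisfies conditions (1)–(4), and for every function f satisfying (1)–(4) we have tops(q) ⊆ f(q) for every state q. -/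

import Mathlib

/-- The kind of a symbol in a visibly pushdown alphabet:
internal, call, or return. -/
inductive SymKind : Type
  | int | call | ret
deriving DecidableEq

/-- A weakly-hierarchical visibly pushdown automaton over states `Q` and
alphabet `S`.  The partition of the alphabet is given by `kind`; the
bottom-of-stack symbol is implicit (stacks are lists of states, the empty
list playing the role of `⊥`, and the head of the list being the topmost
symbol). -/
structure VPA (Q : Type) (S : Type) where
  kind : S → SymKind
  δi : Q → S → Q → Prop
  δc : Q → S → Q → Prop
  δr : Q → S → Q → Q → Prop
  Q0 : Set Q
  F : Set Q
  Q0_nonempty : Q0.Nonempty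
  δi_kind : ∀ p a q, δi p a q → kind a = SymKind.int
  δc_kind : ∀ p c q, δc p c q → kind c = SymKind.call
  δr_kind : ∀ p r qh q, δr p r qh q → kind r = SymKind.ret

namespace VPA

variable {Q S : Type}

/-- A configuration: current state together with the stack
(head = topmost symbol; `[]` = the empty stack `⊥`). -/
abbrev Config (Q : Type) := Q × List Q

/-- One step of the automaton on a symbol. Internal symbols leave the stack
unchanged, call symbols push the current state, return symbols pop the
matching topmost stack symbol. -/
def Step (A : VPA Q S) (c : Config Q) (s : S) (c' : Config Q) : Prop :=
  match A.kind s with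
  | SymKind.int  => A.δi c.1 s c'.1 ∧ c'.2 = c.2
  | SymKind.call => A.δc c.1 s c'.1 ∧ c'.2 = c.1 :: c.2
  | SymKind.ret  => ∃ qh, A.δr c.1 s qh c'.1 ∧ c.2 = qh :: c'.2

/-- `ρ` is a run of `A` on the word `w`. -/
def IsRunOn (A : VPA Q S) (w : List S) (ρ : Fin (w.length + 1) → Config Q) : Prop :=
  ∀ i : Fin w.length, A.Step (ρ i.castSucc) (w.get i) (ρ i.succ)

/-- A run is initial if it starts in an initial state with the empty stack `⊥`. -/
def IsInitial (A : VPA Q S) {n : ℕ} (ρ : Fin (n + 1) → Config Q) : Prop :=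
  (ρ 0).1 ∈ A.Q0 ∧ (ρ 0).2 = []

/-- `A` accepts `w` if some initial run of `A` on `w` ends in an accepting state. -/
def Accepts (A : VPA Q S) (w : List S) : Prop :=
  ∃ ρ : Fin (w.length + 1) → Config Q,
    A.IsRunOn w ρ ∧ A.IsInitial ρ ∧ (ρ (Fin.last w.length)).1 ∈ A.F

/-- The language of `A`. -/
def lang (A : VPA Q S) : Set (List S) := {w | A.Accepts w}

/-- A configuration is reachable if it occurs in some initial run of `A`. -/
def Reachable (A : VPA Q S) (c : Config Q) : Prop :=
  ∃ (w : List S) (ρ : Fin (w.length + 1) → Config Q),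
    A.IsRunOn w ρ ∧ A.IsInitial ρ ∧ ∃ i, ρ i = c

/-- `tops A q` = set of topmost stack symbols of reachable stacks for `q`
(`none` plays the role of the bottom-of-stack symbol `⊥`). -/
def tops (A : VPA Q S) (q : Q) : Set (Option Q) :=
  {t | ∃ σ : List Q, A.Reachable (q, σ) ∧ σ.head? = t}

/-- `A` is live: every state has outgoing transitions for every internal and
call symbol, and has an outgoing return transition for return symbol `s` and
stack symbol `qh` if and only if `qh` is the topmost symbol of some
reachable stack. -/
def Live (A : VPA Q S) : Prop :=
  (∀ q s, A.kind s = SymKind.int → ∃ q', A.δi q s q') ∧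
  (∀ q s, A.kind s = SymKind.call → ∃ q', A.δc q s q') ∧
  (∀ q s qh, A.kind s = SymKind.ret →
    ((∃ q', A.δr q s qh q') ↔ some qh ∈ A.tops q))

/-- `R` is a reachability-aware quotienting (RAQ) relation for `A`. -/
def IsRAQ (A : VPA Q S) (R : Q → Q → Prop) : Prop :=
  Equivalence R ∧
  ∀ p q, R p q →
    (p ∈ A.F ↔ q ∈ A.F) ∧
    (∀ a p', A.δi p a p' → ∃ q', A.δi q a q' ∧ R p' q') ∧
    (∀ a q', A.δi q a q' → ∃ p', A.δi p a p' ∧ R p' q') ∧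
    (∀ c p', A.δc p c p' → ∃ q', A.δc q c q' ∧ R p' q') ∧
    (∀ c q', A.δc q c q' → ∃ p', A.δc p c p' ∧ R p' q') ∧
    (∀ ph qh, R ph qh →
      ((∀ r p', A.δr p r ph p' → ∃ q', A.δr q r qh q' ∧ R p' q') ∧
       (∀ r q', A.δr q r qh q' → ∃ p', A.δr p r ph p' ∧ R p' q'))
      ∨ some qh ∉ A.tops q ∨ some ph ∉ A.tops p)

/-- The quotient VPA `A/R` for an equivalence relation (setoid) `R` on states. -/
def quot (A : VPA Q S) (R : Setoid Q) : VPA (Quotient R) S where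
  kind := A.kind
  δi := fun P a P' => ∃ p p', A.δi p a p' ∧
    Quotient.mk R p = P ∧ Quotient.mk R p' = P'
  δc := fun P c P' => ∃ p p', A.δc p c p' ∧
    Quotient.mk R p = P ∧ Quotient.mk R p' = P'
  δr := fun P r Ph P' => ∃ p ph p', A.δr p r ph p' ∧
    Quotient.mk R p = P ∧ Quotient.mk R ph = Ph ∧ Quotient.mk R p' = P'
  Q0 := {P | ∃ q ∈ A.Q0, Quotient.mk R q = P}
  F := {P | ∃ q ∈ A.F, Quotient.mk R q = P}
  Q0_nonempty := by
    obtain ⟨q, hq⟩ := A.Q0_nonempty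
    exact ⟨Quotient.mk R q, q, hq, rfl⟩
  δi_kind := by rintro P a P' ⟨p, p', h, -, -⟩; exact A.δi_kind p a p' h
  δc_kind := by rintro P c P' ⟨p, p', h, -, -⟩; exact A.δc_kind p c p' h
  δr_kind := by rintro P r Ph P' ⟨p, ph, p', h, -, -, -⟩; exact A.δr_kind p r ph p' h

end VPA

/-- A word is matched-return if every prefix ending in a return symbol
has strictly more call symbols than return symbols before that return. -/
def MR {S : Type} (kind : S → SymKind) (w : List S) : Prop :=
  ∀ v r, (v ++ [r]) <+: w → kind r = SymKind.ret →
    v.countP (fun s => decide (kind s = SymKind.call)) >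
      v.countP (fun s => decide (kind s = SymKind.ret))

/-- `f` satisfies the closure conditions (1)–(4) characterizing `tops`. -/
def TopsClosed {Q S : Type} (A : VPA Q S) (f : Q → Set (Option Q)) : Prop :=
  (∀ q ∈ A.Q0, none ∈ f q) ∧
  (∀ q qh a q', qh ∈ f q → A.δi q a q' → qh ∈ f q') ∧
  (∀ q c q', (∃ σ : List Q, A.Reachable (q, σ)) → A.δc q c q' → some q ∈ f q') ∧
  (∀ q qh r q', some qh ∈ f q → A.δr q r qh q' → f qh ⊆ f q')

namespace VPA

variable {Q S : Type}

/-- Some symbol takes the automaton from the first configuration to the second. -/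
def Move (A : VPA Q S) (c c' : Config Q) : Prop := ∃ s, A.Step c s c'

theorem Move.of_int {A : VPA Q S} {q q' : Q} {a : S} (h : A.δi q a q') (σ : List Q) :
    A.Move (q, σ) (q', σ) := by
  refine ⟨a, ?_⟩
  simp [Step, A.δi_kind _ _ _ h, h]

theorem Move.of_call {A : VPA Q S} {q q' : Q} {c : S} (h : A.δc q c q') (σ : List Q) :
    A.Move (q, σ) (q', q :: σ) := by
  refine ⟨c, ?_⟩
  simp [Step, A.δc_kind _ _ _ h, h]

theorem Move.of_ret {A : VPA Q S} {q qh q' : Q} {r : S} (h : A.δr q r qh q') (σ : List Q) :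
    A.Move (q, qh :: σ) (q', σ) := by
  refine ⟨r, ?_⟩
  simp [Step, A.δr_kind _ _ _ _ h, h]

theorem Move.cases {A : VPA Q S} {q q' : Q} {σ σ' : List Q} (h : A.Move (q, σ) (q', σ')) :
    (∃ a, A.δi q a q' ∧ σ' = σ) ∨ (∃ c, A.δc q c q' ∧ σ' = q :: σ) ∨
      ∃ r qh, A.δr q r qh q' ∧ σ = qh :: σ' := by
  obtain ⟨s, h⟩ := h
  unfold Step at h
  split at h
  · exact Or.inl ⟨s, h⟩
  · exact Or.inr (Or.inl ⟨s, h⟩)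
  · exact Or.inr (Or.inr ⟨s, h⟩)

theorem exists_run_of_reflTransGen {A : VPA Q S} {c c' : Config Q}
    (h : Relation.ReflTransGen A.Move c c') :
    ∃ (w : List S) (ρ : Fin (w.length + 1) → Config Q),
      A.IsRunOn w ρ ∧ ρ 0 = c ∧ ∃ i, ρ i = c' := by
  induction h using Relation.ReflTransGen.head_induction_on with
  | refl => exact ⟨[], fun _ => c', fun i => i.elim0, rfl, 0, rfl⟩
  | @head a b hab _ ih =>
    obtain ⟨w, ρ, hρ, h0, i, hi⟩ := ih
    obtain ⟨s, hs⟩ := hab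
    refine ⟨s :: w, Fin.cons (n := w.length + 1) (α := fun _ => Config Q) a ρ, ?_, rfl, i.succ, hi⟩
    intro j
    refine Fin.cases (n := w.length) ?_ (fun k => ?_) j
    · change A.Step a s (ρ 0)
      rwa [h0]
    · exact hρ k

theorem reachable_iff_reflTransGen {A : VPA Q S} {c : Config Q} :
    A.Reachable c ↔ ∃ q ∈ A.Q0, Relation.ReflTransGen A.Move (q, []) c := by
  constructor
  · rintro ⟨w, ρ, hρ, ⟨hq, hσ⟩, i, rfl⟩
    refine ⟨(ρ 0).1, hq, ?_⟩
    have h0 : ((ρ 0).1, []) = ρ 0 := by rw [← hσ]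
    rw [h0]
    induction i using Fin.induction with
    | zero => exact .refl
    | succ i ih => exact ih.tail ⟨_, hρ i⟩
  · rintro ⟨q, hq, h⟩
    obtain ⟨w, ρ, hρ, h0, hi⟩ := exists_run_of_reflTransGen h
    exact ⟨w, ρ, hρ, by simp [IsInitial, h0, hq], hi⟩

theorem Reachable.initial {A : VPA Q S} {q : Q} (hq : q ∈ A.Q0) : A.Reachable (q, []) :=
  reachable_iff_reflTransGen.2 ⟨q, hq, .refl⟩

theorem Reachable.move {A : VPA Q S} {c c' : Config Q} (h : A.Reachable c) (hm : A.Move c c') :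
    A.Reachable c' := by
  obtain ⟨q, hq, h⟩ := reachable_iff_reflTransGen.1 h
  exact reachable_iff_reflTransGen.2 ⟨q, hq, h.tail hm⟩

theorem Reachable.induction {A : VPA Q S} {P : Q → List Q → Prop}
    (initial : ∀ q ∈ A.Q0, P q [])
    (int : ∀ q σ a q', P q σ → A.δi q a q' → P q' σ)
    (call : ∀ q σ c q', A.Reachable (q, σ) → P q σ → A.δc q c q' → P q' (q :: σ))
    (ret : ∀ q qh σ r q', P q (qh :: σ) → A.δr q r qh q' → P q' σ)
    {q : Q} {σ : List Q} (h : A.Reachable (q, σ)) : P q σ := by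
  obtain ⟨q₀, hq₀, h⟩ := reachable_iff_reflTransGen.1 h
  suffices H : ∀ c, Relation.ReflTransGen A.Move (q₀, []) c → P c.1 c.2 from H _ h
  intro c hc
  induction hc with
  | refl => exact initial q₀ hq₀
  | @tail b c hb hbc ih =>
    obtain ⟨q, σ⟩ := b
    obtain ⟨q', σ'⟩ := c
    obtain ⟨a, ha, rfl⟩ | ⟨a, ha, rfl⟩ | ⟨r, qh, ha, rfl⟩ := hbc.cases
    · exact int _ _ _ _ ih ha
    · exact call _ _ _ _ (reachable_iff_reflTransGen.2 ⟨q₀, hq₀, hb⟩) ih ha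
    · exact ret _ _ _ _ _ ih ha

/-- At every level of the stack, the part below a pushed state may be exchanged for any stack
reachable with that state. -/
def Exchangeable (A : VPA Q S) : Q → List Q → Prop
  | _, [] => True
  | q, qh :: σ =>
    (∀ σ', A.Reachable (qh, σ') → A.Reachable (q, qh :: σ')) ∧ A.Exchangeable qh σ

theorem Reachable.exchangeable {A : VPA Q S} {q : Q} {σ : List Q} (h : A.Reachable (q, σ)) :
    A.Exchangeable q σ := by
  refine h.induction (P := A.Exchangeable) ?_ ?_ ?_ ?_
  · exact fun _ _ => trivial
  · rintro q (_ | ⟨p, σ⟩) a q' hP ha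
    · trivial
    · exact ⟨fun σ' hσ' => (hP.1 σ' hσ').move (.of_int ha _), hP.2⟩
  · exact fun q σ c q' _ hP hc => ⟨fun σ' hσ' => hσ'.move (.of_call hc _), hP⟩
  · rintro q qh (_ | ⟨p, σ⟩) r q' hP hr
    · trivial
    · exact ⟨fun σ' hσ' => (hP.1 _ (hP.2.1 σ' hσ')).move (.of_ret hr _), hP.2.2⟩

theorem topsClosed_tops (A : VPA Q S) : TopsClosed A A.tops := by
  refine ⟨?_, ?_, ?_, ?_⟩
  · exact fun q hq => ⟨[], .initial hq, rfl⟩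
  · rintro q qh a q' ⟨σ, hσ, rfl⟩ ha
    exact ⟨σ, hσ.move (.of_int ha _), rfl⟩
  · rintro q c q' ⟨σ, hσ⟩ hc
    exact ⟨q :: σ, hσ.move (.of_call hc _), rfl⟩
  · rintro q qh r q' ⟨σ, hσ, htop⟩ hr t ⟨σ', hσ', rfl⟩
    obtain ⟨τ, rfl⟩ := List.head?_eq_some_iff.1 htop
    exact ⟨σ', (hσ.exchangeable.1 σ' hσ').move (.of_ret hr _), rfl⟩

/-- At every level of the stack, `f` of the state at that level contains the symbol below it. -/
def TopsIn (f : Q → Set (Option Q)) : Q → List Q → Prop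
  | q, [] => none ∈ f q
  | q, qh :: σ => some qh ∈ f q ∧ TopsIn f qh σ

theorem TopsIn.head?_mem {f : Q → Set (Option Q)} {q : Q} {σ : List Q} (h : TopsIn f q σ) :
    σ.head? ∈ f q := by
  cases σ with
  | nil => exact h
  | cons p σ => exact h.1

theorem TopsIn.of_head?_mem {f : Q → Set (Option Q)} {q q' : Q} {σ : List Q}
    (h : TopsIn f q σ) (h' : σ.head? ∈ f q') : TopsIn f q' σ := by
  cases σ with
  | nil => exact h'
  | cons p σ => exact ⟨h', h.2⟩

theorem Reachable.topsIn {A : VPA Q S} {f : Q → Set (Option Q)} (hf : TopsClosed A f)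
    {q : Q} {σ : List Q} (h : A.Reachable (q, σ)) : TopsIn f q σ := by
  obtain ⟨h_init, h_int, h_call, h_ret⟩ := hf
  refine h.induction (P := TopsIn f) h_init ?_ ?_ ?_
  · exact fun q σ a q' hP ha => hP.of_head?_mem (h_int _ _ _ _ hP.head?_mem ha)
  · exact fun q σ c q' hr hP hc => ⟨h_call _ _ _ ⟨σ, hr⟩ hc, hP⟩
  · exact fun q qh σ r q' hP hr => hP.2.of_head?_mem (h_ret _ _ _ _ hP.1 hr hP.2.head?_mem)

end VPA

/-- `tops` is the smallest function satisfying the closure conditions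
(1)–(4), with respect to pointwise set inclusion. -/
theorem tops_least_closed {Q S : Type} [Fintype Q] [Fintype S] (A : VPA Q S) :
    TopsClosed A A.tops ∧
    ∀ f : Q → Set (Option Q), TopsClosed A f → ∀ q, A.tops q ⊆ f q := by
  refine ⟨A.topsClosed_tops, ?_⟩
  rintro f hf q t ⟨σ, hσ, rfl⟩
  exact (hσ.topsIn hf).head?_mem
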